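/- arXiv:math/9801063 — 2 statements merged into one kernel-verified Lean document; each statement's English description precedes it below -/
import Mathlib

section
/- Let u₀ : ℝ → ℝ be the unique global solution of u' = (1 + u⁴)^{1/4} with u(0) = 0, and define g₀ : (0,∞) → ℝ by g₀(s) = √s · u₀(−½ log s). Then there exists a C^∞ function β : [0,∞) → ℝ such that g₀(s) = β(s²) for all s ∈ (0,∞); in particular g₀ extends to a C^∞ function on [0,∞). -/
open Filter Topology

/-- A solution of `u' = (1 + u⁴)^{1/4}` is smooth. -/
theorem contDiff_of_quartic_ode {u : ℝ → ℝ}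
    (hu : ∀ y : ℝ, HasDerivAt u ((1 + (u y) ^ 4) ^ ((1 : ℝ) / 4)) y) :
    ContDiff ℝ (⊤ : ℕ∞) u := by
  rw [contDiff_infty]
  intro n
  induction n with
  | zero => exact contDiff_zero.2 (continuous_iff_continuousAt.2 fun y => (hu y).continuousAt)
  | succ n ih =>
    push_cast
    rw [contDiff_succ_iff_deriv]
    refine ⟨fun y => (hu y).differentiableAt, by simp, ?_⟩
    rw [funext fun y => (hu y).deriv]
    exact (contDiff_const.add (ih.pow 4)).rpow_const_of_ne fun y => by positivity

/-- A solution of `u' = (1 + u⁴)^{1/4}` with `u 0 = 0` dominates the identity on `[0,∞)`. -/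
theorem le_of_quartic_ode {u : ℝ → ℝ}
    (hu : ∀ y : ℝ, HasDerivAt u ((1 + (u y) ^ 4) ^ ((1 : ℝ) / 4)) y) (h0 : u 0 = 0)
    {y : ℝ} (hy : 0 ≤ y) : y ≤ u y := by
  have hmono : Monotone fun x => u x - x := by
    refine monotone_of_hasDerivAt_nonneg (fun x => (hu x).sub (hasDerivAt_id x)) fun x => ?_
    have : (1 : ℝ) ≤ (1 + (u x) ^ 4) ^ ((1 : ℝ) / 4) :=
      Real.one_le_rpow (by nlinarith [sq_nonneg (u x ^ 2)]) (by norm_num)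
    simpa using this
  have := hmono hy
  simp only [h0] at this
  linarith

/-- The first integral of the equation is `e^{4y}` times this function of `r = u' / u`. -/
noncomputable def quarticPhase (r : ℝ) : ℝ := (r - 1) / (r + 1) * Real.exp (2 * Real.arctan r)

theorem hasDerivAt_quarticPhase {r : ℝ} (hr : r + 1 ≠ 0) :
    HasDerivAt quarticPhase
      (4 * r ^ 2 / ((r + 1) ^ 2 * (1 + r ^ 2)) * Real.exp (2 * Real.arctan r)) r := by
  have h := (((hasDerivAt_id r).sub_const 1).div ((hasDerivAt_id r).add_const 1) hr).mul
    ((Real.hasDerivAt_arctan r).const_mul 2).exp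
  refine h.congr_deriv ?_
  have : 1 + r ^ 2 ≠ 0 := by positivity
  simp only [id, Pi.div_apply]
  field_simp
  ring

theorem contDiffAt_quarticPhase {r : ℝ} (hr : r + 1 ≠ 0) :
    ContDiffAt ℝ (⊤ : ℕ∞) quarticPhase r := by
  unfold quarticPhase
  exact ((contDiffAt_id.sub contDiffAt_const).div (contDiffAt_id.add contDiffAt_const) hr).mul
    (contDiffAt_const.mul Real.contDiff_arctan.contDiffAt).exp

/-- The ratio `u' / u` along a solution, as a function of the value of `u`. -/
noncomputable def quarticRatio (x : ℝ) : ℝ := (1 + x ^ 4) ^ ((1 : ℝ) / 4) / x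

theorem rpow_one_fourth_pow_four {a : ℝ} (ha : 0 ≤ a) : (a ^ ((1 : ℝ) / 4)) ^ 4 = a := by
  rw [← Real.rpow_natCast, ← Real.rpow_mul ha]
  norm_num

theorem quarticRatio_pos {x : ℝ} (hx : 0 < x) : 0 < quarticRatio x := by
  unfold quarticRatio
  positivity

theorem quarticRatio_pow_four {x : ℝ} (hx : 0 < x) : x ^ 4 * (quarticRatio x ^ 4 - 1) = 1 := by
  rw [quarticRatio, div_pow, rpow_one_fourth_pow_four (by positivity)]
  field_simp
  ring

theorem one_lt_quarticRatio {x : ℝ} (hx : 0 < x) : 1 < quarticRatio x := by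
  have h := quarticRatio_pow_four hx
  have hx4 : 0 < x ^ 4 := by positivity
  have : 1 < quarticRatio x ^ 4 := by
    by_contra! hle
    nlinarith
  exact (one_lt_pow_iff_of_nonneg (quarticRatio_pos hx).le (by norm_num)).1 this

theorem quarticRatio_eq {x : ℝ} (hx : 0 < x) :
    quarticRatio x = (1 + x⁻¹ ^ 4) ^ ((1 : ℝ) / 4) := by
  refine (pow_left_inj₀ (quarticRatio_pos hx).le (by positivity) (n := 4) (by norm_num)).1 ?_
  rw [rpow_one_fourth_pow_four (by positivity)]
  have := quarticRatio_pow_four hx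
  field_simp
  linarith

theorem tendsto_quarticRatio_atTop : Tendsto quarticRatio atTop (𝓝 1) := by
  have h : Tendsto (fun x : ℝ => (1 + x⁻¹ ^ 4) ^ ((1 : ℝ) / 4)) atTop (𝓝 1) := by
    have := ((tendsto_inv_atTop_zero (𝕜 := ℝ)).pow 4).const_add 1 |>.rpow_const
      (p := (1 : ℝ) / 4) (by norm_num)
    simpa using this
  refine h.congr' ?_
  filter_upwards [eventually_gt_atTop 0] with x hx using (quarticRatio_eq hx).symm

theorem hasDerivAt_quarticRatio_comp {u : ℝ → ℝ}
    (hu : ∀ y : ℝ, HasDerivAt u ((1 + (u y) ^ 4) ^ ((1 : ℝ) / 4)) y) {y : ℝ} (hy : 0 < u y) :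
    HasDerivAt (fun y => quarticRatio (u y))
      ((1 - quarticRatio (u y) ^ 4) / quarticRatio (u y) ^ 2) y := by
  set p := (1 + (u y) ^ 4) ^ ((1 : ℝ) / 4) with hp
  have hp0 : 0 < p := by positivity
  have hp4 : p ^ 4 = 1 + u y ^ 4 := rpow_one_fourth_pow_four (by positivity)
  have hpow : (1 + (u y) ^ 4) ^ ((1 : ℝ) / 4 - 1) = p / p ^ 4 := by
    rw [Real.rpow_sub (by positivity), Real.rpow_one, hp4]
  have h := ((((hu y).pow 4).const_add 1).rpow_const (p := (1 : ℝ) / 4)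
    (Or.inl (by simp only [Pi.pow_apply]; positivity))).div (hu y) hy.ne'
  refine h.congr_deriv ?_
  simp only [Pi.pow_apply, quarticRatio, ← hp, hpow]
  field_simp
  ring

/-- Along a positive solution `e^{4y} · quarticPhase (u'/u)` has zero derivative. -/
theorem hasDerivAt_quartic_firstIntegral {u : ℝ → ℝ}
    (hu : ∀ y : ℝ, HasDerivAt u ((1 + (u y) ^ 4) ^ ((1 : ℝ) / 4)) y) {y : ℝ} (hy : 0 < u y) :
    HasDerivAt (fun y => quarticPhase (quarticRatio (u y)) * Real.exp (4 * y)) 0 y := by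
  have hr := quarticRatio_pos hy
  have hphase := (hasDerivAt_quarticPhase (by positivity : quarticRatio (u y) + 1 ≠ 0)).comp y
    (hasDerivAt_quarticRatio_comp hu hy)
  refine (hphase.mul ((hasDerivAt_id y).const_mul 4).exp).congr_deriv ?_
  simp only [Function.comp_apply, quarticPhase, id]
  generalize quarticRatio (u y) = r at *
  field_simp
  ring

/-- The first integral is a positive constant on `(0,∞)`. -/
theorem exists_quarticPhase_eq {u : ℝ → ℝ}
    (hu : ∀ y : ℝ, HasDerivAt u ((1 + (u y) ^ 4) ^ ((1 : ℝ) / 4)) y) (h0 : u 0 = 0) :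
    ∃ c : ℝ, 0 < c ∧ ∀ y, 0 < y → quarticPhase (quarticRatio (u y)) = c * Real.exp (-(4 * y)) := by
  have hpos : ∀ y, 0 < y → 0 < u y := fun y hy => hy.trans_le (le_of_quartic_ode hu h0 hy.le)
  refine ⟨quarticPhase (quarticRatio (u 1)) * Real.exp (4 * 1), ?_, fun y hy => ?_⟩
  · have := one_lt_quarticRatio (hpos 1 one_pos)
    have : 0 < quarticRatio (u 1) - 1 := by linarith
    have : 0 < quarticRatio (u 1) + 1 := by linarith
    unfold quarticPhase
    positivity
  · have hd : ∀ x ∈ Set.Ioi (0 : ℝ), HasDerivAt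
        (fun y => quarticPhase (quarticRatio (u y)) * Real.exp (4 * y)) 0 x :=
      fun x hx => hasDerivAt_quartic_firstIntegral hu (hpos x hx)
    have := isOpen_Ioi.is_const_of_deriv_eq_zero (convex_Ioi (0 : ℝ)).isPreconnected
      (fun x hx => (hd x hx).differentiableAt.differentiableWithinAt)
      (fun x hx => (hd x hx).deriv) (Set.mem_Ioi.2 one_pos) (Set.mem_Ioi.2 hy)
    rw [this, mul_assoc, ← Real.exp_add]
    simp

/-- The function `t ↦ t^{1/4} u(-¼ log t)` agrees on a right neighbourhood of `0` with a function
that is smooth at `0`. -/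
theorem exists_contDiffAt_eventuallyEq_quartic {u : ℝ → ℝ}
    (hu : ∀ y : ℝ, HasDerivAt u ((1 + (u y) ^ 4) ^ ((1 : ℝ) / 4)) y) (h0 : u 0 = 0) :
    ∃ B : ℝ → ℝ, ContDiffAt ℝ (⊤ : ℕ∞) B 0 ∧
      ∀ᶠ t in 𝓝[>] (0 : ℝ), t ^ ((1 : ℝ) / 4) * u (-(1 / 4) * Real.log t) = B t := by
  obtain ⟨c, hc, hphase⟩ := exists_quarticPhase_eq hu h0
  have hdiff : ContDiffAt ℝ (⊤ : ℕ∞) quarticPhase 1 := contDiffAt_quarticPhase (by norm_num)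
  have hderiv := hasDerivAt_quarticPhase (r := 1) (by norm_num)
  have hne : 4 * (1 : ℝ) ^ 2 / ((1 + 1) ^ 2 * (1 + 1 ^ 2)) * Real.exp (2 * Real.arctan 1) ≠ 0 := by
    positivity
  have hfderiv := hderiv.hasFDerivAt_equiv hne
  have htop : ((⊤ : ℕ∞) : WithTop ℕ∞) ≠ 0 := by simp
  set ψ := hdiff.localInverse hfderiv htop
  have hψ : ContDiffAt ℝ (⊤ : ℕ∞) ψ 0 := by
    have := hdiff.to_localInverse hfderiv htop
    rwa [show quarticPhase 1 = 0 by simp [quarticPhase]] at this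
  have hleft : ∀ᶠ r in 𝓝 (1 : ℝ), ψ (quarticPhase r) = r :=
    (hdiff.hasStrictFDerivAt' hfderiv htop).eventually_left_inverse
  have hψ0 : ψ 0 = 1 := by
    have := hleft.self_of_nhds
    rwa [show quarticPhase 1 = 0 by simp [quarticPhase]] at this
  refine ⟨fun t => (c⁻¹ * Real.exp (2 * Real.arctan (ψ (c * t))) /
    ((ψ (c * t) + 1) ^ 2 * (ψ (c * t) ^ 2 + 1))) ^ ((1 : ℝ) / 4), ?_, ?_⟩
  · have hψc : ContDiffAt ℝ (⊤ : ℕ∞) (fun t => ψ (c * t)) 0 :=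
      ContDiffAt.comp (g := ψ) 0 (by simpa using hψ) (contDiffAt_const.mul contDiffAt_id)
    refine ContDiffAt.rpow_const_of_ne (ContDiffAt.div (contDiffAt_const.mul
      (contDiffAt_const.mul (Real.contDiff_arctan.contDiffAt.comp 0 hψc)).exp)
      (((hψc.add contDiffAt_const).pow 2).mul ((hψc.pow 2).add contDiffAt_const)) ?_) ?_
    · simp only [mul_zero, hψ0]; norm_num
    · simp only [mul_zero, hψ0]; positivity
  · have hlog : Tendsto (fun t : ℝ => -(1 / 4) * Real.log t) (𝓝[>] 0) atTop :=
      Real.tendsto_log_nhdsGT_zero.const_mul_atBot_of_neg (by norm_num)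
    have hu_top : Tendsto u atTop atTop :=
      tendsto_atTop_mono' _ ((eventually_ge_atTop 0).mono fun y hy => le_of_quartic_ode hu h0 hy)
        tendsto_id
    have hev := (tendsto_quarticRatio_atTop.comp (hu_top.comp hlog)).eventually hleft
    filter_upwards [hev, hlog.eventually (eventually_gt_atTop 0), self_mem_nhdsWithin]
      with t ht hy (htpos : 0 < t)
    have hux : 0 < u (-(1 / 4) * Real.log t) := hy.trans_le (le_of_quartic_ode hu h0 hy.le)
    have hct := hphase _ hy
    rw [show -(4 * (-(1 / 4) * Real.log t)) = Real.log t by ring, Real.exp_log htpos] at hct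
    simp only [Function.comp_apply] at ht
    rw [hct] at ht
    rw [ht]
    have hr := one_lt_quarticRatio hux
    have h4 := quarticRatio_pow_four hux
    generalize u (-(1 / 4) * Real.log t) = x at *
    generalize quarticRatio x = r at *
    have hr0 : 0 < r := by linarith
    refine (pow_left_inj₀ (by positivity) (by positivity) (n := 4) (by norm_num)).1 ?_
    rw [mul_pow, rpow_one_fourth_pow_four htpos.le, rpow_one_fourth_pow_four (by positivity)]
    have hE := Real.exp_pos (2 * Real.arctan r)
    unfold quarticPhase at hct
    generalize Real.exp (2 * Real.arctan r) = E at *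
    rw [eq_div_iff (by positivity), eq_inv_mul_iff_mul_eq₀ hc.ne']
    field_simp at hct
    linear_combination E * h4 - x ^ 4 * (r + 1) * (r ^ 2 + 1) * hct


/-- For the global solution `u₀` of `u' = (1 + u⁴)^{1/4}` with
`u 0 = 0` and `g₀ s = √s · u₀(−½ log s)` for `s > 0`, there is a `C^∞`
function `β` on `[0,∞)` with `g₀ s = β (s²)` for all `s > 0`; in particular
`g₀` extends to a `C^∞` function on `[0,∞)`. -/
theorem g_zero_smooth_extension (u : ℝ → ℝ)
    (hu : ∀ y : ℝ, HasDerivAt u ((1 + (u y) ^ 4) ^ ((1 : ℝ) / 4)) y)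
    (h0 : u 0 = 0)
    (g : ℝ → ℝ)
    (hg : ∀ s : ℝ, 0 < s → g s = Real.sqrt s * u (-(1 / 2) * Real.log s)) :
    ∃ β : ℝ → ℝ, ContDiffOn ℝ (⊤ : ℕ∞) β (Set.Ici 0) ∧
      (∀ s : ℝ, 0 < s → g s = β (s ^ 2)) ∧
      ∃ G : ℝ → ℝ, ContDiffOn ℝ (⊤ : ℕ∞) G (Set.Ici 0) ∧ ∀ s : ℝ, 0 < s → G s = g s := by
  obtain ⟨B, hB, hBeq⟩ := exists_contDiffAt_eventuallyEq_quartic hu h0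
  have hsmooth := contDiff_of_quartic_ode hu
  let β : ℝ → ℝ := Function.update
    (fun t => t ^ ((1 : ℝ) / 4) * u (-(1 / 4) * Real.log t)) 0 (B 0)
  have hβ_of_pos : ∀ t, 0 < t → β t = t ^ ((1 : ℝ) / 4) * u (-(1 / 4) * Real.log t) :=
    fun t ht => Function.update_of_ne ht.ne' _ _
  have hβ : ContDiffOn ℝ (⊤ : ℕ∞) β (Set.Ici 0) := by
    intro t ht
    rcases (Set.mem_Ici.1 ht).eq_or_lt with rfl | ht
    · have hβ0 : β 0 = B 0 := Function.update_self _ _ _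
      refine hB.contDiffWithinAt.congr_of_eventuallyEq ?_ hβ0
      rw [EventuallyEq, ← Set.Ioi_insert, nhdsWithin_insert, eventually_sup, eventually_pure]
      refine ⟨hβ0, ?_⟩
      filter_upwards [hBeq, self_mem_nhdsWithin] with t hBt ht
      rw [hβ_of_pos t ht, hBt]
    · have hdiff : ContDiffAt ℝ (⊤ : ℕ∞)
          (fun t => t ^ ((1 : ℝ) / 4) * u (-(1 / 4) * Real.log t)) t :=
        (Real.contDiffAt_rpow_const_of_ne ht.ne').mul
          (hsmooth.contDiffAt.comp t (contDiffAt_const.mul (Real.contDiffAt_log.2 ht.ne')))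
      refine (hdiff.congr_of_eventuallyEq ?_).contDiffWithinAt
      filter_upwards [eventually_gt_nhds ht] with x hx using hβ_of_pos x hx
  have hgβ : ∀ s : ℝ, 0 < s → g s = β (s ^ 2) := by
    intro s hs
    have hpow : (s ^ 2) ^ ((1 : ℝ) / 4) = √s := by
      rw [Real.sqrt_eq_rpow, ← Real.rpow_natCast s 2, ← Real.rpow_mul hs.le]
      norm_num
    have hlog : -(1 / 4) * Real.log (s ^ 2) = -(1 / 2) * Real.log s := by
      rw [Real.log_pow]
      push_cast
      ring
    rw [hg s hs, hβ_of_pos _ (by positivity), hpow, hlog]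
  refine ⟨β, hβ, hgβ, fun s => β (s ^ 2), ?_, fun s hs => (hgβ s hs).symm⟩
  exact hβ.comp (contDiff_id.pow 2).contDiffOn fun s _ => Set.mem_Ici.2 (sq_nonneg s)
end

section
/- Let a, p ∈ ℝ with either (−2 < a < 2 and p > −a/2) or (a > 2 and p > −1), and let u : ℝ → ℝ be the unique global solution of u' = (1 + a u² + u⁴)^{1/4} with u(0) = 0, so that u'(y)² − u(y)² + p > 0 for all y. Consider the Hamiltonian H_p : ℝ⁴ → ℝ, H_p(φ, y, p_φ, p_y) = ( u'(y)² / (u'(y)² − u(y)² + p) ) (p_φ² + p_y²) − ( (u''(y) − u(y)) u'(y)² / (u'(y)² − u(y)² + p) ) cos φ. Then H_p possesses an integral of fourth degree in momenta: there exist C^∞ functions a_{jk} : ℝ² → ℝ for j + k ≤ 4 such that F(φ, y, p_φ, p_y) = Σ_{j+k≤4} a_{jk}(φ,y) p_φ^j p_y^k satisfies {F, H_p} = 0 everywhere, and the differentials of F and H_p are linearly independent at some point of ℝ⁴. -/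
/-- The canonical Poisson bracket of two functions on `ℝ⁴` with coordinates
`(q₁, q₂, p₁, p₂)`, evaluated at a point. -/
noncomputable def pbracket (F H : ℝ × ℝ × ℝ × ℝ → ℝ) (v : ℝ × ℝ × ℝ × ℝ) : ℝ :=
  deriv (fun t => F (t, v.2.1, v.2.2.1, v.2.2.2)) v.1 *
      deriv (fun t => H (v.1, v.2.1, t, v.2.2.2)) v.2.2.1
    + deriv (fun t => F (v.1, t, v.2.2.1, v.2.2.2)) v.2.1 *
      deriv (fun t => H (v.1, v.2.1, v.2.2.1, t)) v.2.2.2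
    - deriv (fun t => F (v.1, v.2.1, t, v.2.2.2)) v.2.2.1 *
      deriv (fun t => H (t, v.2.1, v.2.2.1, v.2.2.2)) v.1
    - deriv (fun t => F (v.1, v.2.1, v.2.2.1, t)) v.2.2.2 *
      deriv (fun t => H (v.1, t, v.2.2.1, v.2.2.2)) v.2.1

/-- `H` possesses an integral of fourth degree in the momenta: a function
`F = Σ_{j+k≤4} a_{jk}(q₁,q₂) p₁^j p₂^k` with `C^∞` coefficients, Poisson
commuting with `H`, whose differential is linearly independent from that of
`H` at some point. -/
def HasQuarticIntegral (H : ℝ × ℝ × ℝ × ℝ → ℝ) : Prop :=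
  ∃ A : ℕ → ℕ → (ℝ × ℝ → ℝ),
    (∀ j k : ℕ, j + k ≤ 4 → ContDiff ℝ (⊤ : ℕ∞) (A j k)) ∧
    ∃ F : ℝ × ℝ × ℝ × ℝ → ℝ,
      (∀ v : ℝ × ℝ × ℝ × ℝ,
        F v = ∑ jk ∈ Finset.filter (fun jk => jk.1 + jk.2 ≤ 4)
            (Finset.range 5 ×ˢ Finset.range 5),
          A jk.1 jk.2 (v.1, v.2.1) * v.2.2.1 ^ jk.1 * v.2.2.2 ^ jk.2) ∧
      (∀ v : ℝ × ℝ × ℝ × ℝ, pbracket F H v = 0) ∧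
      ∃ v : ℝ × ℝ × ℝ × ℝ,
        LinearIndependent ℝ ![fderiv ℝ F v, fderiv ℝ H v]

open Real

/-- The Hamiltonian `k(y) (p₁² + p₂²) - g(y) k(y) cos q₁`. -/
noncomputable def conformalHamiltonian (g k : ℝ → ℝ) (v : ℝ × ℝ × ℝ × ℝ) : ℝ :=
  k v.2.1 * (v.2.2.1 ^ 2 + v.2.2.2 ^ 2) - g v.2.1 * k v.2.1 * cos v.1

/-- The quartic integral
`2 p₁⁴ - 4 p₁² (H - u cos q₁) - 4 u' sin q₁ p₁ p₂ - (u'² - u² - a/2) sin² q₁`. -/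
noncomputable def quarticIntegral (a : ℝ) (u u₁ g k : ℝ → ℝ) (v : ℝ × ℝ × ℝ × ℝ) : ℝ :=
  2 * v.2.2.1 ^ 4 - 4 * v.2.2.1 ^ 2 * (conformalHamiltonian g k v - u v.2.1 * cos v.1)
    - 4 * u₁ v.2.1 * sin v.1 * v.2.2.1 * v.2.2.2
    - (u₁ v.2.1 ^ 2 - u v.2.1 ^ 2 - a / 2) * sin v.1 ^ 2

/-- The coefficients of `quarticIntegral` as a polynomial in the momenta. -/
noncomputable def quarticCoeff (a : ℝ) (u u₁ g k : ℝ → ℝ) : ℕ → ℕ → ℝ × ℝ → ℝ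
  | 4, 0 => fun q => 2 - 4 * k q.2
  | 2, 2 => fun q => -4 * k q.2
  | 2, 0 => fun q => 4 * (g q.2 * k q.2 + u q.2) * cos q.1
  | 1, 1 => fun q => -4 * u₁ q.2 * sin q.1
  | 0, 0 => fun q => -(u₁ q.2 ^ 2 - u q.2 ^ 2 - a / 2) * sin q.1 ^ 2
  | _, _ => fun _ => 0

theorem quarticCoeff_contDiff (a : ℝ) {u u₁ g k : ℝ → ℝ}
    (hu : ContDiff ℝ (⊤ : ℕ∞) u) (hu₁ : ContDiff ℝ (⊤ : ℕ∞) u₁)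
    (hg : ContDiff ℝ (⊤ : ℕ∞) g) (hk : ContDiff ℝ (⊤ : ℕ∞) k) (i j : ℕ) :
    ContDiff ℝ (⊤ : ℕ∞) (quarticCoeff a u u₁ g k i j) := by
  unfold quarticCoeff
  split <;> fun_prop

theorem quarticIntegral_eq_sum (a : ℝ) (u u₁ g k : ℝ → ℝ) (v : ℝ × ℝ × ℝ × ℝ) :
    quarticIntegral a u u₁ g k v =
      ∑ jk ∈ Finset.filter (fun jk => jk.1 + jk.2 ≤ 4) (Finset.range 5 ×ˢ Finset.range 5),
        quarticCoeff a u u₁ g k jk.1 jk.2 (v.1, v.2.1) * v.2.2.1 ^ jk.1 * v.2.2.2 ^ jk.2 := by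
  simp only [Finset.sum_filter, Finset.sum_product, Finset.sum_range_succ, Finset.sum_range_zero]
  norm_num [quarticCoeff, quarticIntegral, conformalHamiltonian]
  ring

section Partials

variable (a : ℝ) (u u₁ g k : ℝ → ℝ) (q y x w : ℝ)

theorem conformalHamiltonian_hasDerivAt_angle :
    HasDerivAt (fun t => conformalHamiltonian g k (t, y, x, w)) (g y * k y * sin q) q := by
  have h := ((hasDerivAt_cos q).const_mul (g y * k y)).const_sub (k y * (x ^ 2 + w ^ 2))
  exact h.congr_deriv (by ring)

theorem conformalHamiltonian_hasDerivAt_height {g' k' : ℝ}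
    (hg : HasDerivAt g g' y) (hk : HasDerivAt k k' y) :
    HasDerivAt (fun t => conformalHamiltonian g k (q, t, x, w))
      (k' * (x ^ 2 + w ^ 2) - (g' * k y + g y * k') * cos q) y :=
  (hk.mul_const (x ^ 2 + w ^ 2)).sub ((hg.mul hk).mul_const (cos q))

theorem conformalHamiltonian_hasDerivAt_fst :
    HasDerivAt (fun t => conformalHamiltonian g k (q, y, t, w)) (2 * k y * x) x := by
  have h := ((((hasDerivAt_id x).pow 2).add_const (w ^ 2)).const_mul (k y)).sub_const
    (g y * k y * cos q)
  exact h.congr_deriv (by simp; ring)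

theorem conformalHamiltonian_hasDerivAt_snd :
    HasDerivAt (fun t => conformalHamiltonian g k (q, y, x, t)) (2 * k y * w) w := by
  have h := ((((hasDerivAt_id w).pow 2).const_add (x ^ 2)).const_mul (k y)).sub_const
    (g y * k y * cos q)
  exact h.congr_deriv (by simp; ring)

theorem quarticIntegral_hasDerivAt_angle :
    HasDerivAt (fun t => quarticIntegral a u u₁ g k (t, y, x, w))
      (-4 * x ^ 2 * (g y * k y * sin q + u y * sin q) - 4 * u₁ y * cos q * x * w
        - (u₁ y ^ 2 - u y ^ 2 - a / 2) * (2 * sin q * cos q)) q := by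
  have h := ((((((conformalHamiltonian_hasDerivAt_angle g k q y x w).sub
    ((hasDerivAt_cos q).const_mul (u y))).const_mul (4 * x ^ 2)).const_sub (2 * x ^ 4)).sub
    ((((hasDerivAt_sin q).const_mul (4 * u₁ y)).mul_const x).mul_const w)).sub
    (((hasDerivAt_sin q).pow 2).const_mul (u₁ y ^ 2 - u y ^ 2 - a / 2)))
  exact h.congr_deriv (by simp)

theorem quarticIntegral_hasDerivAt_height {u' u₁' g' k' : ℝ}
    (hu : HasDerivAt u u' y) (hu₁ : HasDerivAt u₁ u₁' y)
    (hg : HasDerivAt g g' y) (hk : HasDerivAt k k' y) :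
    HasDerivAt (fun t => quarticIntegral a u u₁ g k (q, t, x, w))
      (-4 * x ^ 2 * (k' * (x ^ 2 + w ^ 2) - (g' * k y + g y * k') * cos q - u' * cos q)
        - 4 * u₁' * sin q * x * w - (2 * u₁ y * u₁' - 2 * u y * u') * sin q ^ 2) y := by
  have h := ((((((conformalHamiltonian_hasDerivAt_height g k q y x w hg hk).sub
    (hu.mul_const (cos q))).const_mul (4 * x ^ 2)).const_sub (2 * x ^ 4)).sub
    ((((hu₁.const_mul 4).mul_const (sin q)).mul_const x).mul_const w)).sub
    ((((hu₁.pow 2).sub (hu.pow 2)).sub_const (a / 2)).mul_const (sin q ^ 2)))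
  exact h.congr_deriv (by simp)

theorem quarticIntegral_hasDerivAt_fst :
    HasDerivAt (fun t => quarticIntegral a u u₁ g k (q, y, t, w))
      (8 * x ^ 3 - 8 * x * (conformalHamiltonian g k (q, y, x, w) - u y * cos q)
        - 4 * x ^ 2 * (2 * k y * x) - 4 * u₁ y * sin q * w) x := by
  have h := ((((((hasDerivAt_id x).pow 4).const_mul 2).sub
    ((((hasDerivAt_id x).pow 2).const_mul 4).mul
      ((conformalHamiltonian_hasDerivAt_fst g k q y x w).sub_const (u y * cos q)))).sub
    (((hasDerivAt_id x).const_mul (4 * u₁ y * sin q)).mul_const w)).sub_const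
    ((u₁ y ^ 2 - u y ^ 2 - a / 2) * sin q ^ 2))
  exact h.congr_deriv (by simp; ring)

theorem quarticIntegral_hasDerivAt_snd :
    HasDerivAt (fun t => quarticIntegral a u u₁ g k (q, y, x, t))
      (-4 * x ^ 2 * (2 * k y * w) - 4 * u₁ y * sin q * x) w := by
  have h := (((((conformalHamiltonian_hasDerivAt_snd g k q y x w).sub_const
    (u y * cos q)).const_mul (4 * x ^ 2)).const_sub (2 * x ^ 4)).sub
    ((hasDerivAt_id w).const_mul (4 * u₁ y * sin q * x))).sub_const
    ((u₁ y ^ 2 - u y ^ 2 - a / 2) * sin q ^ 2)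
  exact h.congr_deriv (by simp)

end Partials

theorem pbracket_quarticIntegral_eq_zero {a : ℝ} {u u₁ u₂ u₃ k k' : ℝ → ℝ}
    (hu : ∀ y, HasDerivAt u (u₁ y) y) (hu₁ : ∀ y, HasDerivAt u₁ (u₂ y) y)
    (hu₂ : ∀ y, HasDerivAt u₂ (u₃ y) y) (hk : ∀ y, HasDerivAt k (k' y) y)
    (hode : ∀ y, 4 * (u₁ y * u₃ y) = 2 * a + 12 * u y ^ 2 - 8 * u₂ y ^ 2)
    (hconf : ∀ y, u₁ y * k' y = 2 * k y * (u₂ y - k y * (u₂ y - u y)))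
    (v : ℝ × ℝ × ℝ × ℝ) :
    pbracket (quarticIntegral a u u₁ (u₂ - u) k) (conformalHamiltonian (u₂ - u) k) v = 0 := by
  obtain ⟨q, y, x, w⟩ := v
  have hg : HasDerivAt (u₂ - u) (u₃ y - u₁ y) y := (hu₂ y).sub (hu y)
  simp only [pbracket]
  rw [(quarticIntegral_hasDerivAt_angle a u u₁ (u₂ - u) k q y x w).deriv,
    (quarticIntegral_hasDerivAt_height a u u₁ (u₂ - u) k q y x w (hu y) (hu₁ y) hg (hk y)).deriv,
    (quarticIntegral_hasDerivAt_fst a u u₁ (u₂ - u) k q y x w).deriv,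
    (quarticIntegral_hasDerivAt_snd a u u₁ (u₂ - u) k q y x w).deriv,
    (conformalHamiltonian_hasDerivAt_angle (u₂ - u) k q y x w).deriv,
    (conformalHamiltonian_hasDerivAt_height (u₂ - u) k q y x w hg (hk y)).deriv,
    (conformalHamiltonian_hasDerivAt_fst (u₂ - u) k q y x w).deriv,
    (conformalHamiltonian_hasDerivAt_snd (u₂ - u) k q y x w).deriv]
  simp only [conformalHamiltonian, Pi.sub_apply]
  linear_combination (4 * sin q * x * (x ^ 2 + w ^ 2 - (u₂ y - u y) * cos q)) * hconf y
    - sin q * x * k y * cos q * hode y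

theorem fderiv_apply_fst_momentum {F : ℝ × ℝ × ℝ × ℝ → ℝ} {q y x w F' : ℝ}
    (hF : DifferentiableAt ℝ F (q, y, x, w))
    (h : HasDerivAt (fun t => F (q, y, t, w)) F' x) :
    fderiv ℝ F (q, y, x, w) (0, 0, 1, 0) = F' := by
  have hline : HasDerivAt (fun t : ℝ => (q, y, t, w)) ((0, 0, 1, 0) : ℝ × ℝ × ℝ × ℝ) x :=
    (hasDerivAt_const x q).prodMk ((hasDerivAt_const x y).prodMk
      ((hasDerivAt_id x).prodMk (hasDerivAt_const x w)))
  exact (hF.hasFDerivAt.comp_hasDerivAt x hline).unique h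

theorem fderiv_apply_snd_momentum {F : ℝ × ℝ × ℝ × ℝ → ℝ} {q y x w F' : ℝ}
    (hF : DifferentiableAt ℝ F (q, y, x, w))
    (h : HasDerivAt (fun t => F (q, y, x, t)) F' w) :
    fderiv ℝ F (q, y, x, w) (0, 0, 0, 1) = F' := by
  have hline : HasDerivAt (fun t : ℝ => (q, y, x, t)) ((0, 0, 0, 1) : ℝ × ℝ × ℝ × ℝ) w :=
    (hasDerivAt_const w q).prodMk ((hasDerivAt_const w y).prodMk
      ((hasDerivAt_const w x).prodMk (hasDerivAt_id w)))
  exact (hF.hasFDerivAt.comp_hasDerivAt w hline).unique h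

theorem quarticIntegral_linearIndependent (a : ℝ) {u u₁ g k : ℝ → ℝ}
    (hu : Differentiable ℝ u) (hu₁ : Differentiable ℝ u₁)
    (hg : Differentiable ℝ g) (hk : Differentiable ℝ k)
    {y : ℝ} (hy : u₁ y ≠ 0) (hky : k y ≠ 0) :
    LinearIndependent ℝ ![fderiv ℝ (quarticIntegral a u u₁ g k) (π / 2, y, 0, 1),
      fderiv ℝ (conformalHamiltonian g k) (π / 2, y, 0, 1)] := by
  have hH : Differentiable ℝ (conformalHamiltonian g k) := by
    unfold conformalHamiltonian
    fun_prop
  have hF : Differentiable ℝ (quarticIntegral a u u₁ g k) := by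
    unfold quarticIntegral
    fun_prop
  rw [LinearIndependent.pair_iff]
  intro s t hst
  have hx := DFunLike.congr_fun hst (0, 0, 1, 0)
  have hw := DFunLike.congr_fun hst (0, 0, 0, 1)
  simp only [_root_.add_apply, _root_.smul_apply,
    _root_.zero_apply, smul_eq_mul] at hx hw
  rw [fderiv_apply_fst_momentum (hF _) (quarticIntegral_hasDerivAt_fst a u u₁ g k _ _ _ _),
    fderiv_apply_fst_momentum (hH _) (conformalHamiltonian_hasDerivAt_fst g k _ _ _ _)] at hx
  rw [fderiv_apply_snd_momentum (hF _) (quarticIntegral_hasDerivAt_snd a u u₁ g k _ _ _ _),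
    fderiv_apply_snd_momentum (hH _) (conformalHamiltonian_hasDerivAt_snd g k _ _ _ _)] at hw
  simpa [hy, hky] using And.intro hx hw

theorem conformalHamiltonian_hasQuarticIntegral {a : ℝ} {u u₁ u₂ u₃ k k' : ℝ → ℝ}
    (su : ContDiff ℝ (⊤ : ℕ∞) u) (su₁ : ContDiff ℝ (⊤ : ℕ∞) u₁)
    (su₂ : ContDiff ℝ (⊤ : ℕ∞) u₂) (sk : ContDiff ℝ (⊤ : ℕ∞) k)
    (hu : ∀ y, HasDerivAt u (u₁ y) y) (hu₁ : ∀ y, HasDerivAt u₁ (u₂ y) y)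
    (hu₂ : ∀ y, HasDerivAt u₂ (u₃ y) y) (hk : ∀ y, HasDerivAt k (k' y) y)
    (hode : ∀ y, 4 * (u₁ y * u₃ y) = 2 * a + 12 * u y ^ 2 - 8 * u₂ y ^ 2)
    (hconf : ∀ y, u₁ y * k' y = 2 * k y * (u₂ y - k y * (u₂ y - u y)))
    (hpos : ∃ y, u₁ y ≠ 0 ∧ k y ≠ 0) :
    HasQuarticIntegral (conformalHamiltonian (u₂ - u) k) := by
  obtain ⟨y, hy, hky⟩ := hpos
  have sg : ContDiff ℝ (⊤ : ℕ∞) (u₂ - u) := su₂.sub su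
  exact ⟨quarticCoeff a u u₁ (u₂ - u) k,
    fun i j _ => quarticCoeff_contDiff a su su₁ sg sk i j,
    quarticIntegral a u u₁ (u₂ - u) k, quarticIntegral_eq_sum a u u₁ (u₂ - u) k,
    pbracket_quarticIntegral_eq_zero hu hu₁ hu₂ hk hode hconf, (π / 2, y, 0, 1),
    quarticIntegral_linearIndependent a (su.differentiable (by simp))
      (su₁.differentiable (by simp)) (sg.differentiable (by simp))
      (sk.differentiable (by simp)) hy hky⟩

theorem contDiff_of_hasDerivAt_comp {u f : ℝ → ℝ} (hf : ContDiff ℝ (⊤ : ℕ∞) f)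
    (hu : ∀ y, HasDerivAt u (f (u y)) y) : ContDiff ℝ (⊤ : ℕ∞) u := by
  rw [contDiff_infty]
  intro n
  induction n with
  | zero =>
    exact contDiff_zero.2 (continuous_iff_continuousAt.2 fun y => (hu y).continuousAt)
  | succ n ih =>
    push_cast
    rw [contDiff_succ_iff_deriv]
    refine ⟨fun y => (hu y).differentiableAt, by simp, ?_⟩
    rw [show deriv u = f ∘ u from funext fun y => (hu y).deriv]
    exact (hf.of_le (by exact_mod_cast le_top)).comp ih

theorem quartic_pos {a : ℝ} (ha : -2 < a) (x : ℝ) : 0 < 1 + a * x ^ 2 + x ^ 4 := by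
  nlinarith [sq_nonneg (x ^ 2 - 1), sq_nonneg x, sq_nonneg (x ^ 2), mul_nonneg
    (by linarith : (0 : ℝ) ≤ a + 2) (sq_nonneg x)]

theorem sub_add_pos_of_sq_eq_quadratic {a p q s : ℝ} (ha : -2 < a) (hp : -1 < p)
    (hap : 0 < a + 2 * p) (hs : 0 ≤ s) (hq : 0 < q) (h : q ^ 2 = 1 + a * s + s ^ 2) :
    0 < q - s + p := by
  by_contra! hle
  have hle' : q ^ 2 ≤ (s - p) ^ 2 := by nlinarith
  rcases le_or_gt p 0 with hp0 | hp0
  · nlinarith [mul_nonneg hap.le hs]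
  · nlinarith [mul_nonneg hap.le (by linarith : 0 ≤ s - p), sq_nonneg (p - 1),
      mul_pos (by linarith : 0 < a + 2) hp0]

/-- For admissible `(a, p)` (i.e. `−2 < a < 2, p > −a/2` or
`a > 2, p > −1`) and `u` the global solution of `u' = (1 + a u² + u⁴)^{1/4}`
with `u 0 = 0` (so that `u'² − u² + p > 0` everywhere), the Hamiltonian
`H_p(φ, y, p_φ, p_y) = (u'²/(u'² − u² + p)) (p_φ² + p_y²)
  − ((u'' − u) u'²/(u'² − u² + p)) cos φ`
possesses an integral of fourth degree in momenta. -/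
theorem hamiltonian_Hp_quartic_integral (a p : ℝ)
    (hap : (-2 < a ∧ a < 2 ∧ -a / 2 < p) ∨ (2 < a ∧ -1 < p))
    (u : ℝ → ℝ)
    (hu : ∀ y : ℝ, HasDerivAt u ((1 + a * (u y) ^ 2 + (u y) ^ 4) ^ ((1 : ℝ) / 4)) y)
    (h0 : u 0 = 0)
    (Hp : ℝ × ℝ × ℝ × ℝ → ℝ)
    (hHp : ∀ v : ℝ × ℝ × ℝ × ℝ,
      Hp v = (deriv u v.2.1) ^ 2 / ((deriv u v.2.1) ^ 2 - (u v.2.1) ^ 2 + p)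
          * (v.2.2.1 ^ 2 + v.2.2.2 ^ 2)
        - (iteratedDeriv 2 u v.2.1 - u v.2.1) * (deriv u v.2.1) ^ 2
            / ((deriv u v.2.1) ^ 2 - (u v.2.1) ^ 2 + p) * Real.cos v.1) :
    (∀ y : ℝ, 0 < (deriv u y) ^ 2 - (u y) ^ 2 + p) ∧
    HasQuarticIntegral Hp := by
  have ha : -2 < a := by rcases hap with h | h <;> linarith [h.1]
  have hp : -1 < p := by
    rcases hap with ⟨_, _, _⟩ | ⟨_, _⟩ <;> linarith
  have hap' : 0 < a + 2 * p := by
    rcases hap with ⟨_, _, _⟩ | ⟨_, _⟩ <;> linarith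
  clear hap
  set f : ℝ → ℝ := fun x => (1 + a * x ^ 2 + x ^ 4) ^ ((1 : ℝ) / 4) with hf
  have hf_pos (x : ℝ) : 0 < f x := rpow_pos_of_pos (quartic_pos ha x) _
  have hf_pow (x : ℝ) : f x ^ 4 = 1 + a * x ^ 2 + x ^ 4 := by
    rw [hf, ← rpow_natCast, ← rpow_mul (quartic_pos ha x).le]
    norm_num
  have hf_smooth : ContDiff ℝ (⊤ : ℕ∞) f :=
    ContDiff.rpow_const_of_ne (by fun_prop) fun x => (quartic_pos ha x).ne'
  have hf_deriv (x : ℝ) : HasDerivAt f ((a * x / 2 + x ^ 3) / f x ^ 3) x := by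
    have hd := (hf_smooth.differentiable (by simp) x).hasDerivAt
    have h4 : HasDerivAt (fun x => f x ^ 4) (2 * a * x + 4 * x ^ 3) x := by
      rw [funext hf_pow]
      have h := ((((hasDerivAt_id x).pow 2).const_mul a).const_add 1).add ((hasDerivAt_id x).pow 4)
      exact h.congr_deriv (by simp; ring)
    have heq := (hd.pow 4).unique h4
    refine hd.congr_deriv ?_
    rw [eq_div_iff (pow_pos (hf_pos x) 3).ne']
    push_cast at heq
    linear_combination heq / 4
  have su : ContDiff ℝ (⊤ : ℕ∞) u := contDiff_of_hasDerivAt_comp hf_smooth hu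
  set u₁ : ℝ → ℝ := fun y => f (u y) with hu₁_def
  set u₂ : ℝ → ℝ := fun y => (a * u y / 2 + u y ^ 3) / u₁ y ^ 2 with hu₂_def
  have hu₁_pos (y : ℝ) : 0 < u₁ y := hf_pos _
  have hu₁_pow (y : ℝ) : u₁ y ^ 4 = 1 + a * u y ^ 2 + u y ^ 4 := hf_pow _
  have hu' (y : ℝ) : HasDerivAt u (u₁ y) y := hu y
  have hu₁ (y : ℝ) : HasDerivAt u₁ (u₂ y) y := by
    refine ((hf_deriv (u y)).comp y (hu' y)).congr_deriv ?_
    have := (hu₁_pos y).ne'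
    change (a * u y / 2 + u y ^ 3) / u₁ y ^ 3 * u₁ y = (a * u y / 2 + u y ^ 3) / u₁ y ^ 2
    field_simp
  have hden (y : ℝ) : 0 < u₁ y ^ 2 - u y ^ 2 + p :=
    sub_add_pos_of_sq_eq_quadratic ha hp hap' (sq_nonneg _) (pow_pos (hu₁_pos y) 2)
      (by linear_combination hu₁_pow y)
  have su₁ : ContDiff ℝ (⊤ : ℕ∞) u₁ := hf_smooth.comp su
  have su₂ : ContDiff ℝ (⊤ : ℕ∞) u₂ :=
    ContDiff.div (by fun_prop) (by fun_prop) fun y => (pow_pos (hu₁_pos y) 2).ne'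
  set k : ℝ → ℝ := fun y => u₁ y ^ 2 / (u₁ y ^ 2 - u y ^ 2 + p) with hk_def
  have sk : ContDiff ℝ (⊤ : ℕ∞) k :=
    ContDiff.div (by fun_prop) (by fun_prop) fun y => (hden y).ne'
  have hderiv : deriv u = u₁ := funext fun y => (hu' y).deriv
  have hderiv₂ : iteratedDeriv 2 u = u₂ := by
    rw [iteratedDeriv_succ, iteratedDeriv_one, hderiv]
    exact funext fun y => (hu₁ y).deriv
  have hH : Hp = conformalHamiltonian (u₂ - u) k := by
    funext v
    rw [hHp, hderiv, hderiv₂]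
    simp only [conformalHamiltonian, hk_def, Pi.sub_apply]
    ring
  refine ⟨fun y => hderiv ▸ hden y, hH ▸ ?_⟩
  have hu₂ (y : ℝ) : HasDerivAt u₂ (deriv u₂ y) y :=
    (su₂.differentiable (by simp) y).hasDerivAt
  have hk (y : ℝ) : HasDerivAt k (deriv k y) y :=
    (sk.differentiable (by simp) y).hasDerivAt
  refine conformalHamiltonian_hasQuarticIntegral (a := a) su su₁ su₂ sk hu' hu₁ hu₂ hk ?_ ?_
    ⟨0, (hu₁_pos 0).ne', (div_pos (pow_pos (hu₁_pos 0) 2) (hden 0)).ne'⟩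
  · intro y
    have hL := (hu₂ y).mul ((hu₁ y).pow 2)
    have hR : HasDerivAt (u₂ * u₁ ^ 2) (a * u₁ y / 2 + 3 * u y ^ 2 * u₁ y) y := by
      have hfun : u₂ * u₁ ^ 2 = fun y => a * u y / 2 + u y ^ 3 :=
        funext fun y => div_mul_cancel₀ _ (pow_pos (hu₁_pos y) 2).ne'
      rw [hfun]
      have h := (((hu' y).const_mul a).div_const 2).add ((hu' y).pow 3)
      exact h.congr_deriv (by simp)
    have heq := hL.unique hR
    simp only [Pi.pow_apply] at heq
    push_cast at heq
    refine mul_left_cancel₀ (hu₁_pos y).ne' ?_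
    linear_combination 4 * heq
  · intro y
    have h := ((hu₁ y).pow 2).div ((((hu₁ y).pow 2).sub ((hu' y).pow 2)).add_const p) (hden y).ne'
    have hd := (hden y).ne'
    rw [(hk y).unique h]
    simp only [hk_def, Pi.pow_apply, Pi.sub_apply]
    field_simp
    push_cast
    ring
end
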